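/- Let K be a field with a ring homomorphism γ: A → K, let ψ be a Drinfeld module of rank 1 over K, and let m ∈ A be a nonzero element with γ(m) ≠ 0 (so the F_q-linear polynomial ψ_m is separable). Let L be a splitting field of ψ_m over K, which is a Galois extension of K, and let T ⊆ L be the set of roots of ψ_m in L; T is an A-module under addition of L and the scalar action a·t := ψ_a(t). Assume T is isomorphic to A/mA as an A-module. Then every element of Gal(L/K) restricts to an A-module automorphism of T, and the resulting group homomorphism Gal(L/K) → Aut_A(T) ≅ (A/mA)^* is injective. In particular the Galois group of K(ψ[m])/K is isomorphic to a subgroup of (A/mA)^*. -/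

import Mathlib

/-- A polynomial `p` over a field is `F_q`-linear (additive) if it is of the form
`∑ i, c i * X ^ (q ^ i)`, i.e. all of its nonzero coefficients sit in degrees `q ^ i`. -/
def IsAddPoly (q : ℕ) {K : Type*} [Field K] (p : Polynomial K) : Prop :=
  ∀ n : ℕ, p.coeff n ≠ 0 → ∃ i : ℕ, n = q ^ i

/-- A Drinfeld module of rank `r` over a field `K` with respect to a ring homomorphism
`γ : A →+* K`. -/
def IsDrinfeldModule (q : ℕ) {A K : Type*} [CommRing A] [Field K]
    (γ : A →+* K) (r : ℕ) (φ : A → Polynomial K) : Prop :=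
  (∀ a : A, IsAddPoly q (φ a)) ∧
  (∀ a b : A, φ (a + b) = φ a + φ b) ∧
  (∀ a b : A, φ (a * b) = (φ a).comp (φ b)) ∧
  (∀ a : A, (φ a).coeff 1 = γ a) ∧
  (∀ a : A, a ≠ 0 → (φ a).natDegree = Nat.card (A ⧸ Ideal.span {a}) ^ r)

/-- Let `ψ` be a rank-one Drinfeld module over `K`, let `m ∈ A` be nonzero with
`γ m ≠ 0`, let `L` be a splitting field of `ψ_m` over `K`, and let
`T = {t ∈ L | ψ_m(t) = 0}` be the set of `m`-torsion points, an `A`-module via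
`a • t = ψ_a(t)`.  Assume `T ≅ A/mA` as `A`-modules (witnessed by a map
`e : A/mA → L` which is injective, has image `T`, is additive, and intertwines
multiplication by `a` with `ψ_a`).  Then every `σ ∈ Gal(L/K)` restricts to an
`A`-module automorphism of `T`, the map `Gal(L/K) → Aut_A(T)` is injective (a `σ`
fixing `T` pointwise is the identity), and consequently `Gal(L/K)` embeds into
`(A/mA)^*`. -/
theorem galois_of_torsion_field_embeds
    (Fq : Type*) [Field Fq] [Fintype Fq] (q : ℕ) (hq : q = Fintype.card Fq)
    (A : Type*) [CommRing A] [IsDomain A] [Algebra Fq A]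
    (hAfin : ∀ a : A, a ≠ 0 → Finite (A ⧸ Ideal.span {a}))
    (K : Type*) [Field K] (γ : A →+* K)
    (ψ : A → Polynomial K) (hψ : IsDrinfeldModule q γ 1 ψ)
    (m : A) (hm : m ≠ 0) (hγm : γ m ≠ 0)
    (L : Type*) [Field L] [Algebra K L]
    (hL : Polynomial.IsSplittingField K L (ψ m))
    (T : Set L) (hT : T = {t : L | Polynomial.eval₂ (algebraMap K L) t (ψ m) = 0})
    -- `T ≅ A/mA` as `A`-modules:
    (e : A ⧸ Ideal.span {m} → L)
    (he_inj : Function.Injective e)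
    (he_range : Set.range e = T)
    (he_add : ∀ x y : A ⧸ Ideal.span {m}, e (x + y) = e x + e y)
    (he_smul : ∀ (a : A) (x : A ⧸ Ideal.span {m}),
      e (Ideal.Quotient.mk (Ideal.span {m}) a * x) =
        Polynomial.eval₂ (algebraMap K L) (e x) (ψ a)) :
    -- every element of `Gal(L/K)` restricts to an `A`-module automorphism of `T`:
    (∀ σ : L ≃ₐ[K] L, Set.BijOn σ T T ∧
        ∀ (a : A), ∀ t ∈ T,
          σ (Polynomial.eval₂ (algebraMap K L) t (ψ a)) =
            Polynomial.eval₂ (algebraMap K L) (σ t) (ψ a)) ∧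
    -- the map `Gal(L/K) → Aut_A(T)` is injective:
    (∀ σ : L ≃ₐ[K] L, (∀ t ∈ T, σ t = t) → σ = 1) ∧
    -- in particular, `Gal(L/K)` is isomorphic to a subgroup of `(A/mA)^*`:
    ∃ ι : (L ≃ₐ[K] L) →* (A ⧸ Ideal.span {m})ˣ, Function.Injective ι := by
  have comm : ∀ (σ : L ≃ₐ[K] L) (p : Polynomial K) (t : L),
      σ (Polynomial.eval₂ (algebraMap K L) t p) =
        Polynomial.eval₂ (algebraMap K L) (σ t) p := fun σ p t =>
    (Polynomial.aeval_algHom_apply σ.toAlgHom t p).symm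
  have maps : ∀ σ : L ≃ₐ[K] L, ∀ t ∈ T, σ t ∈ T := fun σ t ht => by
    simp only [hT, Set.mem_ofPred_eq] at ht ⊢
    rw [← comm, ht, map_zero]
  have faithful : ∀ σ : L ≃ₐ[K] L, (∀ t ∈ T, σ t = t) → σ = 1 := fun σ hσ => by
    have h : σ.toAlgHom = AlgHom.id K L := by
      refine AlgHom.ext_of_adjoin_eq_top hL.adjoin_rootSet' fun t ht => hσ t ?_
      rw [hT]
      exact Polynomial.aeval_eq_zero_of_mem_rootSet ht
    ext t
    exact DFunLike.congr_fun h t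
  refine ⟨fun σ => ⟨⟨maps σ, σ.injective.injOn, fun t ht =>
    ⟨σ.symm t, maps σ.symm t ht, σ.apply_symm_apply t⟩⟩, fun a t _ => comm σ (ψ a) t⟩,
    faithful, ?_⟩
  have lift : ∀ σ : L ≃ₐ[K] L, ∃ x, e x = σ (e 1) := fun σ => by
    have h := maps σ (e 1) (he_range ▸ Set.mem_range_self 1)
    rwa [← he_range] at h
  choose u hu using lift
  have apply_e : ∀ (σ : L ≃ₐ[K] L) (x : A ⧸ Ideal.span {m}), σ (e x) = e (x * u σ) :=
    fun σ x => by
      obtain ⟨a, rfl⟩ := Ideal.Quotient.mk_surjective x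
      rw [he_smul, hu, ← comm, ← he_smul, mul_one]
  let f : (L ≃ₐ[K] L) →* A ⧸ Ideal.span {m} :=
    { toFun := u
      map_one' := he_inj (by rw [hu, AlgEquiv.one_apply])
      map_mul' := fun σ τ => he_inj (by
        rw [hu, AlgEquiv.mul_apply, ← hu τ, apply_e, mul_comm]) }
  refine ⟨f.toHomUnits, (injective_iff_map_eq_one _).2 fun σ hσ => faithful σ ?_⟩
  have h1 : u σ = 1 := congrArg Units.val hσ
  rw [← he_range]
  rintro _ ⟨x, rfl⟩
  rw [apply_e, h1, mul_one]
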